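/- arXiv:1507.08485 — 2 statements merged into one kernel-verified Lean document; each statement's English description precedes it below -/
import Mathlib

section
/- Let n and m be natural numbers. If there exists an equivalence of categories between the n-fold product category Vectⁿ (i.e. the category of functions from Fin n to objects of the category of finite-dimensional ℂ-vector spaces, with componentwise morphisms) and the m-fold product category Vectᵐ, then n = m. -/
open CategoryTheory

universe v w

namespace FGModuleCat

variable {K : Type*} [Field K]

lemma subsingleton_hom_iff (V W : FGModuleCat.{v} K) :
    Subsingleton (V ⟶ W) ↔ Subsingleton V ∨ Subsingleton W := by
  constructor
  · intro h
    by_contra! hVW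
    obtain ⟨hV, hW⟩ := hVW
    obtain ⟨f, g, hfg⟩ := exists_pair_ne (V →ₗ[K] W)
    have hom_eq : (ofHom f : V ⟶ W) = ofHom g := Subsingleton.elim _ _
    exact hfg (congrArg (fun φ : V ⟶ W ↦ φ.hom.hom) hom_eq)
  · rintro (h | h)
    · exact ⟨fun f g ↦ hom_ext (LinearMap.ext fun x ↦ by
        rw [Subsingleton.elim x 0, map_zero, map_zero])⟩
    · exact ⟨fun f g ↦ hom_ext (LinearMap.ext fun x ↦ h.elim _ _)⟩

lemma subsingleton_pi_hom_iff {ι : Type*} (X Y : ι → FGModuleCat.{v} K) :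
    Subsingleton (X ⟶ Y) ↔ ∀ k, Subsingleton (X k) ∨ Subsingleton (Y k) := by
  classical
  simp_rw [← subsingleton_hom_iff]
  constructor
  · refine fun h k ↦ ⟨fun f g ↦ ?_⟩
    let zeroHom : ∀ i, X i ⟶ Y i := fun _ ↦ 0
    have update_eq : (Function.update zeroHom k f : X ⟶ Y) = Function.update zeroHom k g :=
      h.elim _ _
    simpa using congrFun update_eq k
  · exact fun h ↦ ⟨fun f g ↦ funext fun k ↦ (h k).elim _ _⟩

/-- A fully faithful functor between powers of the category of finite-dimensional vector spaces
sends the objects concentrated in one position to objects with pairwise disjoint nonempty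
supports. -/
lemma exists_injective_of_fullyFaithful {ι κ : Type*} (L : FGModuleCat.{v} K) [Nontrivial L]
    {F : (ι → FGModuleCat.{v} K) ⥤ (κ → FGModuleCat.{w} K)} (hF : F.FullyFaithful) :
    ∃ f : ι → κ, Function.Injective f := by
  classical
  let line (i : ι) : ι → FGModuleCat.{v} K := fun k ↦ if k = i then L else of K PUnit
  have hom_line_iff (i j : ι) : Subsingleton (line i ⟶ line j) ↔ i ≠ j := by
    rw [subsingleton_pi_hom_iff]
    constructor
    · rintro h rfl
      have hL : Subsingleton L := by simpa [line] using h i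
      exact not_subsingleton L hL
    · intro hij k
      by_cases hk : k = i
      · right
        have hkj : line j k = of K PUnit := if_neg (hk ▸ hij)
        rw [hkj]
        exact inferInstanceAs (Subsingleton PUnit)
      · left
        have hki : line i k = of K PUnit := if_neg hk
        rw [hki]
        exact inferInstanceAs (Subsingleton PUnit)
  have hom_image_iff (i j : ι) : Subsingleton (F.obj (line i) ⟶ F.obj (line j)) ↔ i ≠ j := by
    rw [← hom_line_iff, hF.homEquiv.subsingleton_congr]
  have exists_support (i : ι) : ∃ k, ¬ Subsingleton (F.obj (line i) k) := by
    by_contra! h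
    exact (hom_image_iff i i).1 ((subsingleton_pi_hom_iff _ _).2 fun k ↦ .inl (h k)) rfl
  choose f hf using exists_support
  refine ⟨f, fun i j hij ↦ ?_⟩
  by_contra hne
  rcases (subsingleton_pi_hom_iff _ _).1 ((hom_image_iff i j).2 hne) (f i) with h | h
  · exact hf i h
  · exact hf j (hij ▸ h)

end FGModuleCat

/-- **Kapranov–Voevodsky rank invariance.** If the `n`-fold
product of the category of finite-dimensional ℂ-vector spaces is equivalent to
the `m`-fold product, then `n = m`. -/
theorem stmt3 (n m : ℕ)
    (h : Nonempty ((Fin n → FGModuleCat ℂ) ≌ (Fin m → FGModuleCat ℂ))) :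
    n = m := by
  obtain ⟨e⟩ := h
  apply le_antisymm
  · simpa using Fintype.card_le_of_injective _
      (FGModuleCat.exists_injective_of_fullyFaithful (.of ℂ (ULift ℂ))
        e.fullyFaithfulFunctor).choose_spec
  · simpa using Fintype.card_le_of_injective _
      (FGModuleCat.exists_injective_of_fullyFaithful (.of ℂ (ULift ℂ))
        e.fullyFaithfulInverse).choose_spec
end

section
/- Let X be a topological space, k ≥ 1 a natural number, and {U_i}_{i ∈ I} an open cover of X. Suppose g_{ij}, f_{ij} : U_i ∩ U_j → GL_k(ℂ) are continuous families with twisting cocycles λ_{ijk}, μ_{ijk} : U_i ∩ U_j ∩ U_k → ℂ* (continuous), satisfying g_{ii} = 1, g_{ji} = g_{ij}^{-1}, g_{ij}·g_{jk} = λ_{ijk}·g_{ik} on triple overlaps, and similarly f_{ii} = 1, f_{ji} = f_{ij}^{-1}, f_{ij}·f_{jk} = μ_{ijk}·f_{ik}. Suppose there exists a family of continuous maps α_i : U_i → GL_k(ℂ) such that for all x ∈ U_i ∩ U_j and all A ∈ M_k(ℂ): f_{ij}(x)·A·f_{ij}(x)^{-1} = (α_i(x)·g_{ij}(x)·α_j(x)^{-1})·A·(α_i(x)·g_{ij}(x)·α_j(x)^{-1})^{-1}.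 Then there exist continuous maps ξ_{ij} : U_i ∩ U_j → ℂ* such that f_{ij}(x) = α_i(x)·ξ_{ij}(x)^{-1}·g_{ij}(x)·α_j(x)^{-1} for all x ∈ U_i ∩ U_j, and ξ_{ij}·ξ_{jk} = λ_{ijk}·μ_{ijk}^{-1}·ξ_{ik} on U_i ∩ U_j ∩ U_k. -/
open Matrix in
/-- Invertible matrices with the same conjugation action are scalar multiples of each other. -/
theorem Matrix.exists_eq_smul_of_conj_eq {n K : Type*} [Fintype n] [DecidableEq n] [CommRing K]
    {F H : Matrix n n K} (hF : IsUnit F) (hH : IsUnit H)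
    (h : ∀ A : Matrix n n K, F * A * F⁻¹ = H * A * H⁻¹) : ∃ c : K, H = c • F := by
  rw [isUnit_iff_isUnit_det] at hF hH
  have hcomm : ∀ A : Matrix n n K, Commute A (F⁻¹ * H) := fun A => by
    calc A * (F⁻¹ * H) = F⁻¹ * (F * A * F⁻¹) * H := by
          simp only [Matrix.mul_assoc, nonsing_inv_mul_cancel_left _ _ hF]
      _ = F⁻¹ * H * A := by
          rw [h]
          simp only [Matrix.mul_assoc, nonsing_inv_mul _ hH, Matrix.mul_one]
  obtain ⟨c, hc⟩ := mem_range_scalar_iff_commute_single'.mpr fun i j => hcomm (single i j 1)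
  refine ⟨c, ?_⟩
  rw [← mul_nonsing_inv_cancel_left F H hF, ← hc, scalar_apply, ← smul_one_eq_diagonal,
    Matrix.mul_smul, Matrix.mul_one]

theorem ContinuousOn.matrix_inv {X n K : Type*} [TopologicalSpace X] [Fintype n] [DecidableEq n]
    [Field K] [TopologicalSpace K] [IsTopologicalDivisionRing K] {M : X → Matrix n n K} {s : Set X}
    (hM : ContinuousOn M s) (hu : ∀ x ∈ s, IsUnit (M x)) : ContinuousOn (fun x => (M x)⁻¹) s := by
  intro x hx
  refine (continuousAt_matrix_inv (M x) ?_).comp_continuousWithinAt (hM x hx)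
  rw [Ring.inverse_eq_inv']
  exact continuousAt_inv₀ ((Matrix.isUnit_iff_isUnit_det _).1 (hu x hx)).ne_zero


/-- If two twisted-vector-bundle cocycles `g` (with twisting
`λ`) and `f` (with twisting `μ`) over an open cover of `X` are conjugate by a
family `α_i : U_i → GL_k(ℂ)` at the level of the induced endomorphism-bundle
cocycles, then they differ by a scalar family `ξ_{ij} : U_i ∩ U_j → ℂ*`
satisfying `ξ_{ij}·ξ_{jk} = λ_{ijk}·μ_{ijk}⁻¹·ξ_{ik}`. -/
theorem stmt7 {X : Type*} [TopologicalSpace X] {k : ℕ} (hk : 1 ≤ k)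
    {I : Type*} (U : I → Set X)
    (hopen : ∀ i, IsOpen (U i)) (hcover : ⋃ i, U i = Set.univ)
    (g f : I → I → X → Matrix (Fin k) (Fin k) ℂ)
    (lam mu : I → I → I → X → ℂ)
    (hgc : ∀ i j, ContinuousOn (g i j) (U i ∩ U j))
    (hfc : ∀ i j, ContinuousOn (f i j) (U i ∩ U j))
    (hlamc : ∀ i j l, ContinuousOn (lam i j l) (U i ∩ U j ∩ U l))
    (hmuc : ∀ i j l, ContinuousOn (mu i j l) (U i ∩ U j ∩ U l))
    (hgu : ∀ i j, ∀ x ∈ U i ∩ U j, IsUnit (g i j x))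
    (hfu : ∀ i j, ∀ x ∈ U i ∩ U j, IsUnit (f i j x))
    (hlam0 : ∀ i j l, ∀ x ∈ U i ∩ U j ∩ U l, lam i j l x ≠ 0)
    (hmu0 : ∀ i j l, ∀ x ∈ U i ∩ U j ∩ U l, mu i j l x ≠ 0)
    (hg1 : ∀ i, ∀ x ∈ U i, g i i x = 1)
    (hg2 : ∀ i j, ∀ x ∈ U i ∩ U j, g j i x = (g i j x)⁻¹)
    (hg3 : ∀ i j l, ∀ x ∈ U i ∩ U j ∩ U l,
      g i j x * g j l x = lam i j l x • g i l x)
    (hf1 : ∀ i, ∀ x ∈ U i, f i i x = 1)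
    (hf2 : ∀ i j, ∀ x ∈ U i ∩ U j, f j i x = (f i j x)⁻¹)
    (hf3 : ∀ i j l, ∀ x ∈ U i ∩ U j ∩ U l,
      f i j x * f j l x = mu i j l x • f i l x)
    (α : I → X → Matrix (Fin k) (Fin k) ℂ)
    (hαc : ∀ i, ContinuousOn (α i) (U i))
    (hαu : ∀ i, ∀ x ∈ U i, IsUnit (α i x))
    (hconj : ∀ i j, ∀ x ∈ U i ∩ U j, ∀ A : Matrix (Fin k) (Fin k) ℂ,
      f i j x * A * (f i j x)⁻¹ =
        (α i x * g i j x * (α j x)⁻¹) * A * (α i x * g i j x * (α j x)⁻¹)⁻¹) :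
    ∃ ξ : I → I → X → ℂ,
      (∀ i j, ContinuousOn (ξ i j) (U i ∩ U j)) ∧
      (∀ i j, ∀ x ∈ U i ∩ U j, ξ i j x ≠ 0) ∧
      (∀ i j, ∀ x ∈ U i ∩ U j,
        f i j x = (ξ i j x)⁻¹ • (α i x * g i j x * (α j x)⁻¹)) ∧
      (∀ i j l, ∀ x ∈ U i ∩ U j ∩ U l,
        ξ i j x * ξ j l x = lam i j l x * (mu i j l x)⁻¹ * ξ i l x) := by
  have : Nonempty (Fin k) := ⟨⟨0, hk⟩⟩
  have hk0 : (k : ℂ) ≠ 0 := Nat.cast_ne_zero.mpr (by omega)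
  let h : I → I → X → Matrix (Fin k) (Fin k) ℂ := fun i j x => α i x * g i j x * (α j x)⁻¹
  have hhu : ∀ i j, ∀ x ∈ U i ∩ U j, IsUnit (h i j x) := fun i j x hx =>
    ((hαu i x hx.1).mul (hgu i j x hx)).mul (Matrix.isUnit_nonsing_inv_iff.mpr (hαu j x hx.2))
  have hhc : ∀ i j, ContinuousOn (h i j) (U i ∩ U j) := fun i j =>
    (((hαc i).mono Set.inter_subset_left).mul (hgc i j)).mul
      (((hαc j).matrix_inv (hαu j)).mono Set.inter_subset_right)
  let ξ : I → I → X → ℂ := fun i j x => ((f i j x)⁻¹ * h i j x).trace / k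
  have hξ : ∀ i j, ∀ x ∈ U i ∩ U j, h i j x = ξ i j x • f i j x := by
    intro i j x hx
    obtain ⟨c, hc⟩ :=
      Matrix.exists_eq_smul_of_conj_eq (hfu i j x hx) (hhu i j x hx) (hconj i j x hx)
    have hdet := (Matrix.isUnit_iff_isUnit_det _).1 (hfu i j x hx)
    have : ξ i j x = c := by
      simp [ξ, hc, Matrix.nonsing_inv_mul _ hdet, hk0]
    rw [this, hc]
  have hξ0 : ∀ i j, ∀ x ∈ U i ∩ U j, ξ i j x ≠ 0 := fun i j x hx h0 =>
    (hhu i j x hx).ne_zero (by rw [hξ i j x hx, h0, zero_smul])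
  refine ⟨ξ, fun i j => ?_, hξ0, fun i j x hx => ?_, fun i j l x hx => ?_⟩
  · exact (continuous_id.matrix_trace.comp_continuousOn
      (((hfc i j).matrix_inv (hfu i j)).mul (hhc i j))).div_const _
  · change f i j x = (ξ i j x)⁻¹ • h i j x
    rw [hξ i j x hx, inv_smul_smul₀ (hξ0 i j x hx)]
  · have hij : x ∈ U i ∩ U j := hx.1
    have hjl : x ∈ U j ∩ U l := ⟨hx.1.2, hx.2⟩
    have hil : x ∈ U i ∩ U l := ⟨hx.1.1, hx.2⟩
    have hαj := (Matrix.isUnit_iff_isUnit_det _).1 (hαu j x hx.1.2)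
    have hmul : h i j x * h j l x = lam i j l x • h i l x := by
      calc h i j x * h j l x = α i x * (g i j x * g j l x) * (α l x)⁻¹ := by
            simp only [h, Matrix.mul_assoc, Matrix.nonsing_inv_mul_cancel_left _ _ hαj]
        _ = lam i j l x • h i l x := by
            simp only [h, hg3 i j l x hx, Matrix.mul_smul, Matrix.smul_mul]
    rw [hξ i j x hij, hξ j l x hjl, hξ i l x hil, smul_mul_smul_comm, hf3 i j l x hx, smul_smul,
      smul_smul] at hmul
    have hscal := smul_left_injective ℂ (hfu i l x hil).ne_zero hmul
    have hmu := hmu0 i j l x hx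
    field_simp
    linear_combination hscal
end
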